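/- arXiv:1509.00191 — 2 statements merged into one kernel-verified Lean document; each statement's English description precedes it below -/
import Mathlib

section
/- Let A be a finite dimensional H₂-module algebra, E = E₀ ⊕ E₁ the Grassmann algebra, and E(A) = (A₀ ⊗ E₀) ⊕ (A₁ ⊗ E₁) its Grassmann envelope. For a multilinear H₂-polynomial f = Σ a_{σ,W,h} W₀ z_{σ(1)}^{h₁} W₁ ⋯ z_{σ(s)}^{h_s} W_s in even variables y and odd variables z, let f̃ = Σ (−1)^σ a_{σ,W,h} W₀ z_{σ(1)}^{h₁} ⋯ z_{σ(s)}^{h_s} W_s. Then f ∈ id^{H₂}(A) if and only if f̃ ∈ id^{H₂}(E(A)). -/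
noncomputable section
open TensorProduct

/-! ## The free `H`-module algebra -/

variable (F : Type) [Field F] (H : Type) [Ring H] [Algebra F H]

/-- The free `H`-module algebra `F^H⟨X⟩` on a set of variables `V`:
the tensor algebra on `F X ⊗ H`. -/
abbrev FreeHMA (V : Type) : Type := TensorAlgebra F ((V →₀ F) ⊗[F] H)

variable {V : Type}

/-- The variable `x_v^h`. -/
def xvar (v : V) (h : H) : FreeHMA F H V :=
  TensorAlgebra.ι F (Finsupp.single v 1 ⊗ₜ[F] h)

/-- The algebra endomorphism of the free `H`-module algebra induced by a linear
substitution of the variables (not touching the `H`-labels). -/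
def substHom (g : V → (V →₀ F)) : FreeHMA F H V →ₐ[F] FreeHMA F H V :=
  TensorAlgebra.lift F ((TensorAlgebra.ι F).comp
    (LinearMap.rTensor H (Finsupp.linearCombination F g)))

/-- `f|_{x_i ↔ x_j}` : swapping two variables. -/
def swapSubst [DecidableEq V] (i j : V) : FreeHMA F H V →ₐ[F] FreeHMA F H V :=
  substHom F H (fun v => Finsupp.single (Equiv.swap i j v) 1)

/-- `f|_{x_i → x_j}` : substituting `x_j` for `x_i`. -/
def renameSubst [DecidableEq V] (i j : V) : FreeHMA F H V →ₐ[F] FreeHMA F H V :=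
  substHom F H (Function.update (fun v => Finsupp.single v 1) i (Finsupp.single j 1))

/-- `f` is alternating on the set of variables `X`. -/
def AlternatingOn [DecidableEq V] (X : Finset V) (f : FreeHMA F H V) : Prop :=
  ∀ i ∈ X, ∀ j ∈ X, i ≠ j → swapSubst F H i j f = -f

/-- `f` involves only variables from `T`. -/
def DependsOnlyOn (f : FreeHMA F H V) (T : Set V) : Prop :=
  f ∈ Algebra.adjoin F {x : FreeHMA F H V | ∃ v ∈ T, ∃ h : H, x = xvar F H v h}

/-- `f` is a multilinear `H`-polynomial in the variables of `supp` (and involves no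
other variables): substituting `α x_i + y` for `x_i` (`y` a fresh variable) gives
`α f + f|_{x_i → y}`. -/
def MultilinearOn [DecidableEq V] (supp S : Finset V) (f : FreeHMA F H V) : Prop :=
  DependsOnlyOn F H f ↑supp ∧ S ⊆ supp ∧
  ∀ i ∈ S, ∀ y, y ∉ supp → ∀ α : F,
    substHom F H (Function.update (fun v => Finsupp.single v 1) i
        (α • Finsupp.single i 1 + Finsupp.single y 1)) f
      = α • f + renameSubst F H i y f

/-! ## `H`-module algebras -/

variable [Coalgebra F H]

/-- An `H`-module algebra structure on an `F`-algebra `A`: an `H`-action by linear maps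
such that `h·(ab) = (h₍₁₎·a)(h₍₂₎·b)` and `h·1 = ε(h)1`. -/
structure HMA (A : Type) [Ring A] [Algebra F A] where
  act : H →ₗ[F] A →ₗ[F] A
  act_one : act 1 = LinearMap.id
  act_mul : ∀ h k : H, act (h * k) = (act h).comp (act k)
  act_algebraOne : ∀ h : H, act h 1 = (Coalgebra.counit (R := F) h) • (1 : A)
  act_mul_compat :
    (TensorProduct.lift act).comp ((LinearMap.mul' F A).lTensor H)
      = (LinearMap.mul' F A).comp
          (((TensorProduct.map (TensorProduct.lift act) (TensorProduct.lift act)).comp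
            (TensorProduct.tensorTensorTensorComm F H H A A).toLinearMap).comp
            ((Coalgebra.comul (R := F) (A := H)).rTensor (A ⊗[F] A)))

variable {A : Type} [Ring A] [Algebra F A]

/-- Evaluation of `H`-polynomials at an assignment `v : V → A` of the variables,
sending `x_v^h` to `h · (v v)`. -/
def HMA.eval (M : HMA F H A) (v : V → A) : FreeHMA F H V →ₐ[F] A :=
  TensorAlgebra.lift F
    (TensorProduct.lift ((M.act.flip).comp (Finsupp.linearCombination F v)))

/-- The set of `H`-identities of `A` (in variables `V`). -/
def HMA.idSet (M : HMA F H A) (V : Type) : Set (FreeHMA F H V) :=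
  {f | ∀ v : V → A, M.eval F H v f = 0}

/-- The `F`-subspace of `H`-identities of `A`. -/
def HMA.idSub (M : HMA F H A) (V : Type) : Submodule F (FreeHMA F H V) :=
  ⨅ v : V → A, LinearMap.ker (M.eval F H v).toLinearMap

/-! ## `H`-T-ideals -/

/-- The canonical `H`-module algebra structure on the free `H`-module algebra is
characterized by `h · x_v^k = x_v^{hk}` on generators. -/
def IsFreeAction (𝔉 : HMA F H (FreeHMA F H V)) : Prop :=
  ∀ (h k : H) (p : V →₀ F),
    𝔉.act h (TensorAlgebra.ι F (p ⊗ₜ[F] k)) = TensorAlgebra.ι F (p ⊗ₜ[F] (h * k))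

/-- An `H`-T-ideal: a two-sided ideal of the free `H`-module algebra stable under all
`H`-endomorphisms, i.e. under all substitutions of the variables by arbitrary
`H`-polynomials (`𝔉` is the free `H`-action). -/
def IsHTIdeal (𝔉 : HMA F H (FreeHMA F H V)) (Γ : Set (FreeHMA F H V)) : Prop :=
  (0 : FreeHMA F H V) ∈ Γ ∧
  (∀ f g, f ∈ Γ → g ∈ Γ → f + g ∈ Γ) ∧
  (∀ f g, f ∈ Γ → g * f ∈ Γ ∧ f * g ∈ Γ) ∧
  (∀ (v : V → FreeHMA F H V) f, f ∈ Γ → 𝔉.eval F H v f ∈ Γ)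

/-- The `H`-T-ideal generated by a set of `H`-polynomials. -/
def hTIdealSpan (𝔉 : HMA F H (FreeHMA F H V)) (s : Set (FreeHMA F H V)) :
    Set (FreeHMA F H V) :=
  ⋂₀ {Γ | IsHTIdeal F H 𝔉 Γ ∧ s ⊆ Γ}

/-- `Γ` contains the `t`-th Capelli identity: every multilinear `H`-polynomial
alternating in `t` variables belongs to `Γ`. -/
def SatisfiesCapelli (Γ : Set (FreeHMA F H ℕ)) (t : ℕ) : Prop :=
  ∀ (f : FreeHMA F H ℕ) (supp X : Finset ℕ),
    MultilinearOn F H supp supp f → X ⊆ supp → X.card = t → AlternatingOn F H X f → f ∈ Γ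

/-! ## The Kemer index -/

/-- There are, for every `μ`, multilinear `H`-polynomials outside `Γ` alternating on `μ`
disjoint (small) sets of cardinality `a` and on `s` further disjoint (big) sets of
cardinality `a+1`. -/
def HasKemerAlt (Γ : Set (FreeHMA F H ℕ)) (a s : ℕ) : Prop :=
  ∀ μ : ℕ, ∃ (supp : Finset ℕ) (f : FreeHMA F H ℕ)
      (Xs : Fin μ → Finset ℕ) (Ys : Fin s → Finset ℕ),
    f ∉ Γ ∧ MultilinearOn F H supp supp f ∧
    (∀ i, Xs i ⊆ supp) ∧ (∀ j, Ys j ⊆ supp) ∧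
    (∀ i, (Xs i).card = a) ∧ (∀ j, (Ys j).card = a + 1) ∧
    Pairwise (fun i i' => Disjoint (Xs i) (Xs i')) ∧
    Pairwise (fun j j' => Disjoint (Ys j) (Ys j')) ∧
    (∀ i j, Disjoint (Xs i) (Ys j)) ∧
    (∀ i, AlternatingOn F H (Xs i) f) ∧ (∀ j, AlternatingOn F H (Ys j) f)

/-- `α(Γ)`, the first component of the Kemer index. -/
def kemerAlpha (Γ : Set (FreeHMA F H ℕ)) : ℕ :=
  sSup {a | HasKemerAlt F H Γ a 0}

/-- `s(Γ)`, the second component of the Kemer index. -/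
def kemerS (Γ : Set (FreeHMA F H ℕ)) : ℕ :=
  sSup {s | HasKemerAlt F H Γ (kemerAlpha F H Γ) s}

/-- The Kemer index `Ind(Γ) = (α(Γ), s(Γ))`. -/
def kemerIndex (Γ : Set (FreeHMA F H ℕ)) : ℕ × ℕ :=
  (kemerAlpha F H Γ, kemerS F H Γ)

/-- An `H`-Kemer polynomial of `Γ` of rank `μ`. -/
def IsKemerPoly (Γ : Set (FreeHMA F H ℕ)) (μ : ℕ) (f : FreeHMA F H ℕ) : Prop :=
  ∃ (supp : Finset ℕ) (Xs : Fin μ → Finset ℕ)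
      (Ys : Fin (kemerS F H Γ) → Finset ℕ),
    f ∉ Γ ∧ MultilinearOn F H supp supp f ∧
    (∀ i, Xs i ⊆ supp) ∧ (∀ j, Ys j ⊆ supp) ∧
    (∀ i, (Xs i).card = kemerAlpha F H Γ) ∧
    (∀ j, (Ys j).card = kemerAlpha F H Γ + 1) ∧
    Pairwise (fun i i' => Disjoint (Xs i) (Xs i')) ∧
    Pairwise (fun j j' => Disjoint (Ys j) (Ys j')) ∧
    (∀ i j, Disjoint (Xs i) (Ys j)) ∧
    (∀ i, AlternatingOn F H (Xs i) f) ∧ (∀ j, AlternatingOn F H (Ys j) f)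

/-! ## Finite dimensional `H`-module algebras, radicals and parameters -/

/-- A bundled finite dimensional `H`-module algebra. -/
structure FDHMA where
  carrier : Type
  [ring : Ring carrier]
  [alg : Algebra F carrier]
  fd : FiniteDimensional F carrier
  M : HMA F H carrier

attribute [instance] FDHMA.ring FDHMA.alg

/-- The Jacobson radical of an `F`-algebra, as an `F`-subspace. -/
def jacRad (A : Type) [Ring A] [Algebra F A] : Submodule F A :=
  ((⊥ : Ideal A).jacobson).restrictScalars F

/-- The nilpotency index `n_A` of the Jacobson radical. -/
def nilIndex (A : Type) [Ring A] : ℕ :=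
  sInf {n : ℕ | ((⊥ : Ideal A).jacobson) ^ n = ⊥}

/-- `d(A)`, the dimension of the semisimple part `A/J(A)`. -/
def ssDim (A : Type) [Ring A] [Algebra F A] : ℕ :=
  Module.finrank F (A ⧸ jacRad F A)

/-- The parameter `Par(A) = (d(A), n_A - 1)` of a finite dimensional algebra. -/
def par (A : FDHMA F H) : ℕ × ℕ :=
  (ssDim F A.carrier, nilIndex A.carrier - 1)

/-- The `H`-identities (in countably many variables) of a bundled algebra. -/
def FDHMA.ids (A : FDHMA F H) : Set (FreeHMA F H ℕ) :=
  A.M.idSet F H ℕ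

/-- An `H`-basic algebra: not `H`-PI-equivalent to a finite direct product of finite
dimensional `H`-module algebras of strictly smaller parameter. -/
def IsHBasic (A : FDHMA F H) : Prop :=
  ¬ ∃ (s : ℕ) (B : Fin s → FDHMA F H),
      (∀ i, toLex (par F H (B i)) < toLex (par F H A)) ∧
      A.ids F H = ⋂ i, (B i).ids F H

/-- The `H`-ideal of an `H`-module algebra generated by a set. -/
def hIdealSpan (M : HMA F H A) (s : Set A) : Submodule F A :=
  sInf {I : Submodule F A | s ⊆ I ∧ (∀ a : A, ∀ x ∈ I, a * x ∈ I ∧ x * a ∈ I) ∧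
    (∀ h : H, ∀ x ∈ I, M.act h x ∈ I)}

/-- The Grassmann (exterior) algebra `E` over `F` on countably many generators. -/
abbrev GrassmannAlg (F : Type) [Field F] : Type := ExteriorAlgebra F (ℕ →₀ F)

/-- The even part `E₀` of the Grassmann algebra: the span of products of an even number
of generators. -/
def grassEven (F : Type) [Field F] : Submodule F (GrassmannAlg F) :=
  Submodule.span F {x | ∃ l : List (ℕ →₀ F), l.length % 2 = 0 ∧
    x = (l.map (ExteriorAlgebra.ι F)).prod}

/-- The odd part `E₁` of the Grassmann algebra. -/
def grassOdd (F : Type) [Field F] : Submodule F (GrassmannAlg F) :=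
  Submodule.span F {x | ∃ l : List (ℕ →₀ F), l.length % 2 = 1 ∧
    x = (l.map (ExteriorAlgebra.ι F)).prod}

/-- `A' ⊗ E'` as a subspace of `A ⊗ E`. -/
def envPart (F : Type) [Field F] {A : Type} [Ring A] [Algebra F A]
    (A' : Submodule F A) (E' : Submodule F (GrassmannAlg F)) :
    Submodule F (A ⊗[F] GrassmannAlg F) :=
  Submodule.span F {x | ∃ a ∈ A', ∃ e ∈ E', x = a ⊗ₜ[F] e}

/-- The set of `H₂`-identities, i.e. graded `H`-identities, of a superalgebra
`B = B₀ ⊕ B₁` with `H`-action, in `n` even variables `y` and `s` odd variables `z`. -/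
def superIdSet (F : Type) [Field F] (H : Type) [Ring H] [Algebra F H] [Coalgebra F H]
    {B : Type} [Ring B] [Algebra F B] (MB : HMA F H B) (B₀ B₁ : Submodule F B)
    (n s : ℕ) : Set (FreeHMA F H (Fin n ⊕ Fin s)) :=
  {f | ∀ v : (Fin n ⊕ Fin s) → B,
    (∀ i, v (Sum.inl i) ∈ B₀) → (∀ j, v (Sum.inr j) ∈ B₁) → MB.eval F H v f = 0}

/-- The word `W = y_{i₁}^{h_{i₁}} ⋯` in even variables given by a list `l`. -/
def wordY (F : Type) [Field F] (H : Type) [Ring H] [Algebra F H]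
    (n s : ℕ) (hy : Fin n → H) (l : List (Fin n)) : FreeHMA F H (Fin n ⊕ Fin s) :=
  (l.map fun i => xvar F H (Sum.inl i : Fin n ⊕ Fin s) (hy i)).prod

/-- The multilinear supermonomial `W₀ z_{σ(1)}^{h₁} W₁ z_{σ(2)}^{h₂} ⋯ z_{σ(s)}^{h_s} W_s`
determined by a permutation `σ` of the odd variables, gap words `g` of even variables,
and `H`-labels `hy`, `hz`. -/
def superMono (F : Type) [Field F] (H : Type) [Ring H] [Algebra F H]
    (n s : ℕ) (σ : Equiv.Perm (Fin s)) (g : Fin (s + 1) → List (Fin n))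
    (hy : Fin n → H) (hz : Fin s → H) : FreeHMA F H (Fin n ⊕ Fin s) :=
  wordY F H n s hy (g 0) *
    ((List.finRange s).map fun k =>
      xvar F H (Sum.inr (σ k) : Fin n ⊕ Fin s) (hz k) * wordY F H n s hy (g k.succ)).prod


section MyHelpers

lemma aux_eval_xvar {F : Type} [Field F] {H : Type} [Ring H] [Algebra F H] [Coalgebra F H]
    {V : Type} {B : Type} [Ring B] [Algebra F B] (M : HMA F H B) (v : V → B) (i : V) (h : H) :
    M.eval F H v (xvar F H i h) = M.act h (v i) := by
  simp [HMA.eval, xvar]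

lemma aux_eval_list {F : Type} [Field F] {H : Type} [Ring H] [Algebra F H] [Coalgebra F H]
    {V : Type} {B : Type} [Ring B] [Algebra F B] (M : HMA F H B) (v : V → B) (L : List (V × H)) :
    M.eval F H v ((L.map fun p => xvar F H p.1 p.2).prod)
      = (L.map fun p => M.act p.2 (v p.1)).prod := by
  rw [map_list_prod, List.map_map]
  congr 1
  apply List.map_congr_left
  intro p _
  simp [aux_eval_xvar]

/-- the list of labelled variables of a monomial -/
def auxList {H : Type} (n s : ℕ) (σ : Equiv.Perm (Fin s)) (g : Fin (s + 1) → List (Fin n))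
    (hy : Fin n → H) (hz : Fin s → H) : List ((Fin n ⊕ Fin s) × H) :=
  (g 0).map (fun i => (Sum.inl i, hy i)) ++
    (List.finRange s).flatMap (fun k =>
      (Sum.inr (σ k), hz k) :: (g k.succ).map (fun i => (Sum.inl i, hy i)))

lemma aux_superMono {F : Type} [Field F] {H : Type} [Ring H] [Algebra F H]
    (n s : ℕ) (σ : Equiv.Perm (Fin s)) (g : Fin (s + 1) → List (Fin n))
    (hy : Fin n → H) (hz : Fin s → H) :
    superMono F H n s σ g hy hz
      = ((auxList n s σ g hy hz).map fun p => xvar F H p.1 p.2).prod := by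
  have key : ∀ l : List (Fin s),
      (l.map fun k =>
        xvar F H (Sum.inr (σ k) : Fin n ⊕ Fin s) (hz k) * wordY F H n s hy (g k.succ)).prod
      = ((l.flatMap (fun k =>
      ((Sum.inr (σ k) : Fin n ⊕ Fin s), hz k) ::
        (g k.succ).map (fun i => ((Sum.inl i : Fin n ⊕ Fin s), hy i)))).map
          fun p => xvar F H p.1 p.2).prod := by
    intro l
    induction l with
    | nil => simp
    | cons k l ih =>
      rw [List.map_cons, List.prod_cons, ih]
      simp [wordY, Function.comp_def, mul_assoc]
  rw [superMono, key, auxList]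
  simp [wordY, Function.comp_def]

lemma aux_left {H : Type} (n s : ℕ) (σ : Equiv.Perm (Fin s)) (g : Fin (s + 1) → List (Fin n))
    (hy : Fin n → H) (hz : Fin s → H) :
    ((auxList n s σ g hy hz).map Prod.fst).filterMap Sum.getLeft? = (List.ofFn g).flatten := by
  have key : ∀ l : List (Fin s),
      ((l.flatMap (fun k =>
      ((Sum.inr (σ k) : Fin n ⊕ Fin s), hz k) ::
        (g k.succ).map (fun i => ((Sum.inl i : Fin n ⊕ Fin s), hy i)))).map
          Prod.fst).filterMap Sum.getLeft? = (l.map fun k => g k.succ).flatten := by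
    intro l
    induction l with
    | nil => simp
    | cons k l ih =>
      rw [List.flatMap_cons, List.map_append, List.filterMap_append, ih]
      simp [Function.comp_def, List.filterMap_map, List.filterMap_cons]
  rw [auxList, List.map_append, List.filterMap_append, key, List.ofFn_succ, List.flatten_cons,
    List.ofFn_eq_map]
  simp [Function.comp_def, List.filterMap_map]

lemma aux_right {H : Type} (n s : ℕ) (σ : Equiv.Perm (Fin s)) (g : Fin (s + 1) → List (Fin n))
    (hy : Fin n → H) (hz : Fin s → H) :
    ((auxList n s σ g hy hz).map Prod.fst).filterMap Sum.getRight? = List.ofFn σ := by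
  have key : ∀ l : List (Fin s),
      ((l.flatMap (fun k =>
      ((Sum.inr (σ k) : Fin n ⊕ Fin s), hz k) ::
        (g k.succ).map (fun i => ((Sum.inl i : Fin n ⊕ Fin s), hy i)))).map
          Prod.fst).filterMap Sum.getRight? = l.map σ := by
    intro l
    induction l with
    | nil => simp
    | cons k l ih =>
      rw [List.flatMap_cons, List.map_append, List.filterMap_append, ih]
      simp [Function.comp_def, List.filterMap_map, List.filterMap_cons]
  rw [auxList, List.map_append, List.filterMap_append, key, List.ofFn_eq_map]
  simp [Function.comp_def, List.filterMap_map]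

lemma aux_perm_split {α β : Type} (l : List (α ⊕ β)) :
    l.Perm ((l.filterMap Sum.getLeft?).map Sum.inl ++ (l.filterMap Sum.getRight?).map Sum.inr) := by
  induction l with
  | nil => simp
  | cons x l ih =>
    cases x with
    | inl a => simpa [List.filterMap_cons] using ih
    | inr b =>
      simp only [List.filterMap_cons, Sum.getLeft?_inr, Sum.getRight?_inr, List.map_cons]
      exact (ih.cons _).trans List.perm_middle.symm

lemma aux_prod_split {α β B : Type} [Ring B] (e : α ⊕ β → B)
    (hc : ∀ a x, Commute (e (Sum.inl a)) (e x)) (l : List (α ⊕ β)) :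
    (l.map e).prod = ((l.filterMap Sum.getLeft?).map (fun a => e (Sum.inl a))).prod
      * ((l.filterMap Sum.getRight?).map (fun b => e (Sum.inr b))).prod := by
  induction l with
  | nil => simp
  | cons x l ih =>
    cases x with
    | inl a => simp [ih, mul_assoc, List.filterMap_cons]
    | inr b =>
      simp only [List.filterMap_cons, Sum.getLeft?_inr, Sum.getRight?_inr, List.map_cons,
        List.prod_cons, ih]
      rw [← mul_assoc, ← mul_assoc]
      congr 1
      have : Commute (e (Sum.inr b))
          ((l.filterMap Sum.getLeft?).map (fun a => e (Sum.inl a))).prod := by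
        apply Commute.list_prod_right
        intro y hy
        obtain ⟨a, _, rfl⟩ := List.mem_map.1 hy
        exact (hc a _).symm
      exact this

lemma aux_nodup {H : Type} (n s : ℕ) (σ : Equiv.Perm (Fin s)) (g : Fin (s + 1) → List (Fin n))
    (hy : Fin n → H) (hz : Fin s → H)
    (hw : ((List.ofFn g).flatten).Perm (List.finRange n)) :
    ((auxList n s σ g hy hz).map Prod.fst).Nodup ∧
      ∀ i, i ∈ (auxList n s σ g hy hz).map Prod.fst := by
  have hp := aux_perm_split ((auxList n s σ g hy hz).map Prod.fst)
  rw [aux_left, aux_right] at hp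
  constructor
  · rw [hp.nodup_iff, List.nodup_append]
    refine ⟨?_, ?_, ?_⟩
    · exact ((hw.nodup_iff).2 (List.nodup_finRange n)).map Sum.inl_injective
    · exact (List.nodup_ofFn.2 σ.injective).map Sum.inr_injective
    · intro a ha b hb
      obtain ⟨a, _, rfl⟩ := List.mem_map.1 ha
      obtain ⟨b, _, rfl⟩ := List.mem_map.1 hb
      simp
  · intro i
    rw [hp.mem_iff]
    cases i with
    | inl i => simp only [List.mem_append]; left
               exact List.mem_map.2 ⟨i, (hw.mem_iff).2 (List.mem_finRange i), rfl⟩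
    | inr j => simp only [List.mem_append]; right
               exact List.mem_map.2 ⟨j, (List.mem_ofFn' _ _).2 ⟨σ.symm j, by simp⟩, rfl⟩

lemma aux_linear {F : Type} [Field F] {H : Type} [Ring H] [Algebra F H] [Coalgebra F H]
    {V : Type} [DecidableEq V] {B : Type} [Ring B] [Algebra F B] (M : HMA F H B)
    (L : List (V × H)) (hnd : (L.map Prod.fst).Nodup) (i : V) (hi : i ∈ L.map Prod.fst)
    (v : V → B) :
    ∃ φ : B →ₗ[F] B, ∀ x, φ x =
      (L.map fun p => M.act p.2 (Function.update v i x p.1)).prod := by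
  obtain ⟨⟨i', h⟩, hp, rfl⟩ := List.mem_map.1 hi
  obtain ⟨L1, L2, rfl⟩ := List.append_of_mem hp
  simp only [List.map_append, List.map_cons, List.nodup_append, List.nodup_cons] at hnd
  obtain ⟨h1, ⟨h2, h3⟩, h4⟩ := hnd
  refine ⟨(LinearMap.mulLeft F (L1.map fun p => M.act p.2 (v p.1)).prod).comp
    ((LinearMap.mulRight F (L2.map fun p => M.act p.2 (v p.1)).prod).comp (M.act h)), ?_⟩
  intro x
  have e1 : (L1.map fun p => M.act p.2 (Function.update v i' x p.1))
      = L1.map fun p => M.act p.2 (v p.1) := by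
    apply List.map_congr_left
    intro p hp
    rw [Function.update_of_ne]
    exact h4 _ (List.mem_map_of_mem hp) _ (by simp)
  have e2 : (L2.map fun p => M.act p.2 (Function.update v i' x p.1))
      = L2.map fun p => M.act p.2 (v p.1) := by
    apply List.map_congr_left
    intro p hp2
    rw [Function.update_of_ne]
    rintro rfl
    exact h2 (List.mem_map_of_mem hp2)
  simp [e1, e2]

lemma aux_span {F : Type} [Field F] {V : Type} [Fintype V] [DecidableEq V] {B C : Type}
    [AddCommGroup B] [Module F B] [AddCommGroup C] [Module F C] (Φ : (V → B) → C)
    (hlin : ∀ v i, ∃ φ : B →ₗ[F] C, ∀ x, φ x = Φ (Function.update v i x))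
    (S : V → Set B) (h0 : ∀ v, (∀ i, v i ∈ S i) → Φ v = 0) (v : V → B)
    (hv : ∀ i, v i ∈ Submodule.span F (S i)) : Φ v = 0 := by
  have key : ∀ T : Finset V, ∀ v : V → B, (∀ i ∈ T, v i ∈ Submodule.span F (S i)) →
      (∀ i, i ∉ T → v i ∈ S i) → Φ v = 0 := by
    intro T
    induction T using Finset.induction_on with
    | empty => intro v _ h; exact h0 v (fun i => h i (by simp))
    | insert a T ha ih =>
      intro v h1 h2
      obtain ⟨φ, hφ⟩ := hlin v a
      have hle : Submodule.span F (S a) ≤ LinearMap.ker φ := by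
        rw [Submodule.span_le]
        intro x hx
        rw [SetLike.mem_coe, LinearMap.mem_ker, hφ]
        apply ih
        · intro i hi
          rw [Function.update_of_ne (by rintro rfl; exact ha hi)]
          exact h1 i (Finset.mem_insert_of_mem hi)
        · intro i hi
          by_cases hia : i = a
          · subst hia; simpa using hx
          · rw [Function.update_of_ne hia]
            exact h2 i (by simp [hi, hia])
      have := hle (h1 a (Finset.mem_insert_self _ _))
      rw [LinearMap.mem_ker, hφ, Function.update_eq_self] at this
      exact this
  exact key Finset.univ v (fun i _ => hv i) (fun i hi => absurd (Finset.mem_univ i) hi)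

lemma aux_ι_list {F : Type} [Field F] (m : ℕ →₀ F) (l : List (ℕ →₀ F)) :
    ExteriorAlgebra.ι F m * (l.map (ExteriorAlgebra.ι F)).prod
      = (-1 : GrassmannAlg F) ^ l.length * ((l.map (ExteriorAlgebra.ι F)).prod
        * ExteriorAlgebra.ι F m) := by
  induction l with
  | nil => simp
  | cons a l ih =>
    have h : ExteriorAlgebra.ι F m * ExteriorAlgebra.ι F a
        = - (ExteriorAlgebra.ι F a * ExteriorAlgebra.ι F m) :=
      eq_neg_of_add_eq_zero_left (ExteriorAlgebra.ι_add_mul_swap m a)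
    have hc : Commute ((-1 : GrassmannAlg F) ^ l.length) (ExteriorAlgebra.ι F a) :=
      (Commute.neg_one_left _).pow_left _
    rw [List.map_cons, List.prod_cons, ← mul_assoc, h, neg_mul, mul_assoc, ih, ← mul_assoc,
      ← hc.eq, List.length_cons, pow_succ]
    simp [mul_assoc]

lemma aux_list_list {F : Type} [Field F] (l l' : List (ℕ →₀ F)) :
    (l'.map (ExteriorAlgebra.ι F)).prod * (l.map (ExteriorAlgebra.ι F)).prod
      = (-1 : GrassmannAlg F) ^ (l'.length * l.length) * ((l.map (ExteriorAlgebra.ι F)).prod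
        * (l'.map (ExteriorAlgebra.ι F)).prod) := by
  induction l' with
  | nil => simp
  | cons a l' ih =>
    have hc : Commute ((-1 : GrassmannAlg F) ^ (l'.length * l.length)) (ExteriorAlgebra.ι F a) :=
      (Commute.neg_one_left _).pow_left _
    rw [List.map_cons, List.prod_cons, mul_assoc, ih, ← mul_assoc, ← hc.eq, mul_assoc,
      ← mul_assoc (ExteriorAlgebra.ι F a), aux_ι_list, List.length_cons, Nat.succ_mul, pow_add]
    simp only [mul_assoc]

lemma aux_even_even {F : Type} [Field F] {x y : GrassmannAlg F} (hx : x ∈ grassEven F)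
    (hy : y ∈ grassEven F ∨ y ∈ grassOdd F) : Commute x y := by
  have key : ∀ (l l' : List (ℕ →₀ F)), l.length % 2 = 0 →
      Commute (l.map (ExteriorAlgebra.ι F)).prod (l'.map (ExteriorAlgebra.ι F)).prod := by
    intro l l' hl
    have := aux_list_list l' l
    rwa [Even.neg_one_pow ((Nat.even_iff.2 hl).mul_right _), one_mul] at this
  have key2 : ∀ (l' : List (ℕ →₀ F)), Commute x (l'.map (ExteriorAlgebra.ι F)).prod := by
    intro l'
    induction hx using Submodule.span_induction with
    | mem x h => obtain ⟨l, hl, rfl⟩ := h; exact key l l' hl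
    | zero => exact Commute.zero_left _
    | add a b _ _ ha hb => exact ha.add_left hb
    | smul c a _ ha => exact ha.smul_left c
  rcases hy with hy | hy
  all_goals
    induction hy using Submodule.span_induction with
    | mem x h => obtain ⟨l, hl, rfl⟩ := h; exact key2 l
    | zero => exact Commute.zero_right _
    | add a b _ _ ha hb => exact ha.add_right hb
    | smul c a _ ha => exact ha.smul_right c

lemma aux_odd_odd {F : Type} [Field F] {x y : GrassmannAlg F} (hx : x ∈ grassOdd F)
    (hy : y ∈ grassOdd F) : x * y = - (y * x) := by
  induction hx using Submodule.span_induction with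
  | mem x h =>
    obtain ⟨l, hl, rfl⟩ := h
    induction hy using Submodule.span_induction with
    | mem x h =>
      obtain ⟨l', hl', rfl⟩ := h
      rw [aux_list_list l' l, Odd.neg_one_pow ((Nat.odd_iff.2 hl).mul (Nat.odd_iff.2 hl'))]
      simp
    | zero => simp
    | add a b _ _ ha hb => rw [mul_add, add_mul, ha, hb]; abel
    | smul c a _ ha => rw [mul_smul_comm, smul_mul_assoc, ha, smul_neg]
  | zero => simp
  | add a b _ _ ha hb => rw [mul_add, add_mul, ha, hb]; abel
  | smul c a _ ha => rw [mul_smul_comm, smul_mul_assoc, ha, smul_neg]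

lemma aux_sign {F : Type} [Field F] [CharZero F] (s : ℕ) (ε : Fin s → GrassmannAlg F)
    (hε : ∀ j, ε j ∈ grassOdd F) (σ : Equiv.Perm (Fin s)) :
    (List.ofFn fun k => ε (σ k)).prod = (Equiv.Perm.sign σ : ℤ) • (List.ofFn ε).prod := by
  have hsq : ∀ m : grassOdd F, (grassOdd F).subtype m * (grassOdd F).subtype m = 0 := by
    intro m
    have := aux_odd_odd m.2 m.2
    have h2 : (2 : F) • ((m : GrassmannAlg F) * (m : GrassmannAlg F)) = 0 := by
      rw [two_smul]; nth_rewrite 1 [this]; simp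
    exact (smul_eq_zero.1 h2).resolve_left two_ne_zero
  let ψ := ExteriorAlgebra.lift F ⟨(grassOdd F).subtype, hsq⟩
  have hψ : ∀ w : Fin s → grassOdd F, ψ (ExteriorAlgebra.ιMulti F s w)
      = (List.ofFn fun k => (w k : GrassmannAlg F)).prod := by
    intro w
    rw [ExteriorAlgebra.ιMulti_apply, map_list_prod, List.map_ofFn]
    congr 2
    funext k
    simp [ψ]
  have h := (ExteriorAlgebra.ιMulti F s).map_perm (fun k => (⟨ε k, hε k⟩ : grassOdd F)) σ
  have h' := congrArg ψ h
  rw [Units.smul_def, map_zsmul, hψ, hψ] at h'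
  exact h'

lemma aux_ne_zero (F : Type) [Field F] (s : ℕ) :
    (List.ofFn fun k : Fin s =>
      (ExteriorAlgebra.ι F (Finsupp.single (k : ℕ) (1 : F)) : GrassmannAlg F)).prod ≠ 0 := by
  intro h
  let r : (ℕ →₀ F) →ₗ[F] (Fin s → F) := LinearMap.pi fun j => Finsupp.lapply (j : ℕ)
  let d : (ℕ →₀ F) [⋀^Fin s]→ₗ[F] F := (Matrix.detRowAlternating (n := Fin s) (R := F)).compLinearMap r
  let f : ∀ i, (ℕ →₀ F) [⋀^Fin i]→ₗ[F] F := Pi.single s d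
  have h1 := ExteriorAlgebra.liftAlternating_apply_ιMulti f
    (fun k : Fin s => Finsupp.single (k : ℕ) (1 : F))
  rw [ExteriorAlgebra.ιMulti_apply, h, map_zero] at h1
  have h2 : f s = d := Pi.single_eq_same _ _
  rw [h2] at h1
  have h3 : (fun k : Fin s => r (Finsupp.single (k : ℕ) (1 : F))) = (1 : Matrix (Fin s) (Fin s) F) := by
    funext i j
    simp [r, Matrix.one_apply, Finsupp.single_apply, Fin.ext_iff]
  have h4 : d (fun k : Fin s => Finsupp.single (k : ℕ) (1 : F)) = 1 := by
    change Matrix.det (fun k : Fin s => r (Finsupp.single (k : ℕ) (1 : F))) = 1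
    rw [h3, Matrix.det_one]
  rw [h4] at h1
  exact zero_ne_one h1

lemma aux_tmul_list {F : Type} [Field F] {A E ι : Type} [Ring A] [Algebra F A] [Ring E]
    [Algebra F E] (a : ι → A) (e : ι → E) (L : List ι) :
    (L.map fun p => a p ⊗ₜ[F] e p).prod = (L.map a).prod ⊗ₜ[F] (L.map e).prod := by
  induction L with
  | nil => simp [Algebra.TensorProduct.one_def]
  | cons x l ih => simp [ih]

/-- Evaluation of a signed monomial at pure tensors. -/
lemma aux_mono_eval {F : Type} [Field F] [CharZero F] {H : Type} [Ring H] [Algebra F H]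
    [Coalgebra F H] {A : Type} [Ring A] [Algebra F A] (MA : HMA F H A)
    (ME : HMA F H (A ⊗[F] GrassmannAlg F))
    (hME : ∀ (h : H) (a : A) (e : GrassmannAlg F),
      ME.act h (a ⊗ₜ[F] e) = MA.act h a ⊗ₜ[F] e)
    (n s : ℕ) (σ : Equiv.Perm (Fin s)) (g : Fin (s + 1) → List (Fin n))
    (hy : Fin n → H) (hz : Fin s → H)
    (hw : ((List.ofFn g).flatten).Perm (List.finRange n))
    (a : Fin n ⊕ Fin s → A) (e : Fin n ⊕ Fin s → GrassmannAlg F)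
    (he0 : ∀ i, e (Sum.inl i) ∈ grassEven F) (he1 : ∀ j, e (Sum.inr j) ∈ grassOdd F) :
    ME.eval F H (fun i => a i ⊗ₜ[F] e i)
        ((Equiv.Perm.sign σ : ℤ) • superMono F H n s σ g hy hz)
      = (MA.eval F H a (superMono F H n s σ g hy hz)) ⊗ₜ[F]
        (((List.finRange n).map fun i => e (Sum.inl i)).prod
          * (List.ofFn fun j => e (Sum.inr j)).prod) := by
  have hc : ∀ i x, Commute (e (Sum.inl i)) (e x) := by
    intro i x
    apply aux_even_even (he0 i)
    cases x with
    | inl x => exact Or.inl (he0 x)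
    | inr x => exact Or.inr (he1 x)
  rw [map_zsmul, aux_superMono, aux_eval_list, aux_eval_list]
  simp only [hME]
  rw [aux_tmul_list (fun p : (Fin n ⊕ Fin s) × H => MA.act p.2 (a p.1)) (fun p => e p.1)]
  have h1 : ((auxList n s σ g hy hz).map fun p => e p.1)
      = ((auxList n s σ g hy hz).map Prod.fst).map e := by simp [Function.comp_def]
  rw [h1, aux_prod_split e hc, aux_left, aux_right, List.map_ofFn]
  have h2 : (((List.ofFn g).flatten).map fun i => e (Sum.inl i)).prod
      = ((List.finRange n).map fun i => e (Sum.inl i)).prod := by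
    apply (hw.map _).prod_eq'
    rw [List.pairwise_map]
    exact List.pairwise_of_forall (fun i j => hc i _)
  have h3 := aux_sign s (fun j => e (Sum.inr j)) he1 σ
  rw [h2]
  change _ • (_ ⊗ₜ[F] (_ * (List.ofFn fun k => e (Sum.inr (σ k))).prod)) = _
  rw [h3, mul_smul_comm, TensorProduct.tmul_smul, smul_smul]
  rcases Int.units_eq_one_or (Equiv.Perm.sign σ) with h | h <;> simp [h]

lemma aux_tmul_ne {F : Type} [Field F] {A E : Type} [AddCommGroup A] [Module F A]
    [AddCommGroup E] [Module F E] {x : A} {e : E} (he : e ≠ 0) (h : x ⊗ₜ[F] e = 0) : x = 0 := by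
  obtain ⟨φ, hφ⟩ : ∃ φ : Module.Dual F E, φ e ≠ 0 := by
    by_contra! hc
    exact he ((Module.forall_dual_apply_eq_zero_iff F e).1 hc)
  have := congrArg (fun t => TensorProduct.rid F A (LinearMap.lTensor A φ t)) h
  simp only [LinearMap.lTensor_tmul, TensorProduct.rid_tmul, map_zero] at this
  exact (smul_eq_zero.1 this).resolve_left hφ

end MyHelpers

/-- Let `A` be a finite dimensional `H₂`-module algebra (a superalgebra
`A = A₀ ⊕ A₁` with `H`-action preserving the grading), `E = E₀ ⊕ E₁` the Grassmann
algebra and `E(A) = (A₀ ⊗ E₀) ⊕ (A₁ ⊗ E₁)` its Grassmann envelope.  For a multilinear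
`H₂`-polynomial `f = Σ a_{σ,W,h} W₀ z_{σ(1)}^{h₁} W₁ ⋯ z_{σ(s)}^{h_s} W_s` let
`f̃ = Σ (-1)^σ a_{σ,W,h} W₀ z_{σ(1)}^{h₁} ⋯ z_{σ(s)}^{h_s} W_s`.  Then
`f ∈ id^{H₂}(A)` if and only if `f̃ ∈ id^{H₂}(E(A))`. -/
theorem grassmann_tilde_identity_transfer
    (F : Type) [Field F] [CharZero F] (H : Type) [Ring H] [HopfAlgebra F H]
    [FiniteDimensional F H] [IsSemisimpleRing H]
    (A : Type) [Ring A] [Algebra F A] [FiniteDimensional F A] (MA : HMA F H A)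
    (A₀ A₁ : Submodule F A) (hcompl : IsCompl A₀ A₁)
    (hone : (1 : A) ∈ A₀)
    (hmul00 : ∀ x ∈ A₀, ∀ y ∈ A₀, x * y ∈ A₀) (hmul11 : ∀ x ∈ A₁, ∀ y ∈ A₁, x * y ∈ A₀)
    (hmul01 : ∀ x ∈ A₀, ∀ y ∈ A₁, x * y ∈ A₁) (hmul10 : ∀ x ∈ A₁, ∀ y ∈ A₀, x * y ∈ A₁)
    (hstable0 : ∀ (h : H), ∀ x ∈ A₀, MA.act h x ∈ A₀)
    (hstable1 : ∀ (h : H), ∀ x ∈ A₁, MA.act h x ∈ A₁)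
    -- the `H`-module algebra structure of `A ⊗ E`, `h·(a ⊗ e) = (h·a) ⊗ e`:
    (ME : HMA F H (A ⊗[F] GrassmannAlg F))
    (hME : ∀ (h : H) (a : A) (e : GrassmannAlg F),
      ME.act h (a ⊗ₜ[F] e) = MA.act h a ⊗ₜ[F] e)
    -- the multilinear `H₂`-polynomial `f`, presented by its coefficients:
    (n s N : ℕ) (c : Fin N → F) (σs : Fin N → Equiv.Perm (Fin s))
    (gs : Fin N → Fin (s + 1) → List (Fin n))
    (hys : Fin N → Fin n → H) (hzs : Fin N → Fin s → H)
    (hwords : ∀ i, ((List.ofFn (gs i)).flatten).Perm (List.finRange n)) :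
    ((∑ i, c i • superMono F H n s (σs i) (gs i) (hys i) (hzs i))
        ∈ superIdSet F H MA A₀ A₁ n s) ↔
    ((∑ i, c i • ((Equiv.Perm.sign (σs i) : ℤ) •
          superMono F H n s (σs i) (gs i) (hys i) (hzs i)))
        ∈ superIdSet F H ME (envPart F A₀ (grassEven F)) (envPart F A₁ (grassOdd F)) n s) := by
  classical
  -- evaluation at pure tensors
  have pure_eval : ∀ (a : Fin n ⊕ Fin s → A) (e : Fin n ⊕ Fin s → GrassmannAlg F),
      (∀ i, e (Sum.inl i) ∈ grassEven F) → (∀ j, e (Sum.inr j) ∈ grassOdd F) →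
      ME.eval F H (fun i => a i ⊗ₜ[F] e i)
        (∑ i, c i • ((Equiv.Perm.sign (σs i) : ℤ) •
          superMono F H n s (σs i) (gs i) (hys i) (hzs i)))
      = (MA.eval F H a (∑ i, c i • superMono F H n s (σs i) (gs i) (hys i) (hzs i))) ⊗ₜ[F]
        (((List.finRange n).map fun i => e (Sum.inl i)).prod
          * (List.ofFn fun j => e (Sum.inr j)).prod) := by
    intro a e he0 he1
    rw [map_sum, map_sum, TensorProduct.sum_tmul]
    apply Finset.sum_congr rfl
    intro i _
    rw [map_smul (MA.eval F H a), map_smul (ME.eval F H _) (c i),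
      aux_mono_eval MA ME hME n s _ _ _ _ (hwords i) a e he0 he1, TensorProduct.smul_tmul']
  constructor
  · intro hf v hv0 hv1
    let S : Fin n ⊕ Fin s → Set (A ⊗[F] GrassmannAlg F) := Sum.elim
      (fun _ => {x | ∃ a ∈ A₀, ∃ e ∈ grassEven F, x = a ⊗ₜ[F] e})
      (fun _ => {x | ∃ a ∈ A₁, ∃ e ∈ grassOdd F, x = a ⊗ₜ[F] e})
    refine aux_span (F := F) (fun v => ME.eval F H v
        (∑ i, c i • ((Equiv.Perm.sign (σs i) : ℤ) •
          superMono F H n s (σs i) (gs i) (hys i) (hzs i)))) ?_ S ?_ v ?_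
    · intro v j
      have := fun i => aux_linear ME (auxList n s (σs i) (gs i) (hys i) (hzs i))
        (aux_nodup n s (σs i) (gs i) (hys i) (hzs i) (hwords i)).1 j
        ((aux_nodup n s (σs i) (gs i) (hys i) (hzs i) (hwords i)).2 j) v
      choose φ hφ using this
      refine ⟨∑ i, c i • ((Equiv.Perm.sign (σs i) : ℤ) • φ i), fun x => ?_⟩
      rw [map_sum, LinearMap.sum_apply]
      apply Finset.sum_congr rfl
      intro i _
      rw [map_smul (ME.eval F H _) (c i), map_zsmul, aux_superMono, aux_eval_list, ← hφ]
      rfl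
    · intro v hv
      have hv' : ∀ i, ∃ (a : A) (e : GrassmannAlg F), v i = a ⊗ₜ[F] e ∧
          (∀ k, i = Sum.inl k → a ∈ A₀ ∧ e ∈ grassEven F) ∧
          (∀ k, i = Sum.inr k → a ∈ A₁ ∧ e ∈ grassOdd F) := by
        intro i
        have := hv i
        cases i with
        | inl k =>
          obtain ⟨a, ha, e, he, h⟩ := this
          exact ⟨a, e, h, fun _ _ => ⟨ha, he⟩, by simp⟩
        | inr k =>
          obtain ⟨a, ha, e, he, h⟩ := this
          exact ⟨a, e, h, by simp, fun _ _ => ⟨ha, he⟩⟩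
      choose a e hae h0 h1 using hv'
      have hveq : v = fun i => a i ⊗ₜ[F] e i := funext hae
      have hfa := hf a (fun i => (h0 _ i rfl).1) (fun i => (h1 _ i rfl).1)
      change ME.eval F H v _ = 0
      rw [hveq, pure_eval a e (fun i => (h0 _ i rfl).2) (fun i => (h1 _ i rfl).2), hfa,
        TensorProduct.zero_tmul]
    · intro i
      cases i with
      | inl i => exact hv0 i
      | inr i => exact hv1 i
  · intro hf a ha0 ha1
    let e : Fin n ⊕ Fin s → GrassmannAlg F := Sum.elim (fun _ => 1)
      (fun j => ExteriorAlgebra.ι F (Finsupp.single (j : ℕ) (1 : F)))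
    have he0 : ∀ i, e (Sum.inl i) ∈ grassEven F := fun i =>
      Submodule.subset_span ⟨[], by simp, by simp [e]⟩
    have he1 : ∀ j, e (Sum.inr j) ∈ grassOdd F := fun j =>
      Submodule.subset_span ⟨[Finsupp.single (j : ℕ) (1 : F)], by simp, by simp [e]⟩
    have h := hf (fun i => a i ⊗ₜ[F] e i)
      (fun i => Submodule.subset_span ⟨_, ha0 i, _, he0 i, rfl⟩)
      (fun i => Submodule.subset_span ⟨_, ha1 i, _, he1 i, rfl⟩)
    rw [pure_eval a e he0 he1] at h
    have hne : ((List.finRange n).map fun i => e (Sum.inl i)).prod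
          * (List.ofFn fun j => e (Sum.inr j)).prod ≠ 0 := by
      have h1 : ((List.finRange n).map fun i => e (Sum.inl i)).prod = 1 := by
        simp [e]
      rw [h1, one_mul]
      exact aux_ne_zero F s
    exact aux_tmul_ne hne h
end
end

section
/- For any H₂-module algebra A and every n, the H-codimension of the Grassmann envelope satisfies c_n^H(E(A)) ≤ c_n^{H₂}(A): the linear map P_n^H/(P_n^H ∩ id^H(E(A))) → P_n^{H₂}/(P_n^{H₂} ∩ id^{H₂}(E(A))) induced by x_i ↦ y_i + z_i is injective, and c_n^{H₂}(E(A)) = c_n^{H₂}(A). -/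
noncomputable section
open TensorProduct

/-! ## The free `H`-module algebra -/

variable (F : Type) [Field F] (H : Type) [Ring H] [Algebra F H]

variable {V : Type}

/-! ## `H`-module algebras -/

variable [Coalgebra F H]

variable {A : Type} [Ring A] [Algebra F A]

/-- The space `P_n^H` of multilinear `H`-polynomials in the variables `x₀,...,x_{n-1}`:
the span of the monomials `x_{σ(1)}^{h₁} ⋯ x_{σ(n)}^{h_n}`. -/
def PnH (F : Type) [Field F] (H : Type) [Ring H] [Algebra F H] (n : ℕ) :
    Submodule F (FreeHMA F H ℕ) :=
  Submodule.span F {m | ∃ (σ : Equiv.Perm (Fin n)) (h : Fin n → H),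
    m = (List.ofFn fun k => xvar F H ((σ k : Fin n) : ℕ) (h k)).prod}

/-- The space `P_n^{H₂}` of multilinear `H₂`-polynomials: each variable `x_i` is split
as `y_i + z_i` into an even variable `Sum.inl i` and an odd variable `Sum.inr i`. -/
def PnH2 (F : Type) [Field F] (H : Type) [Ring H] [Algebra F H] (n : ℕ) :
    Submodule F (FreeHMA F H (ℕ ⊕ ℕ)) :=
  Submodule.span F {m | ∃ (σ : Equiv.Perm (Fin n)) (ε : Fin n → Bool) (h : Fin n → H),
    m = (List.ofFn fun k => xvar F H
      (if ε k then Sum.inl ((σ k : Fin n) : ℕ) else Sum.inr ((σ k : Fin n) : ℕ)) (h k)).prod}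

/-- The substitution `x_i ↦ y_i + z_i` from `H`-polynomials to `H₂`-polynomials. -/
def splitHom (F : Type) [Field F] (H : Type) [Ring H] [Algebra F H] :
    FreeHMA F H ℕ →ₐ[F] FreeHMA F H (ℕ ⊕ ℕ) :=
  TensorAlgebra.lift F ((TensorAlgebra.ι F).comp
    (LinearMap.rTensor H (Finsupp.linearCombination F
      (fun i : ℕ => Finsupp.single (Sum.inl i : ℕ ⊕ ℕ) (1 : F) +
        Finsupp.single (Sum.inr i : ℕ ⊕ ℕ) 1))))

/-- The subspace of graded (`H₂`-) identities of a superalgebra `B = B₀ ⊕ B₁`, in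
countably many even variables `Sum.inl k` and odd variables `Sum.inr k`. -/
def superIdSub (F : Type) [Field F] (H : Type) [Ring H] [Algebra F H] [Coalgebra F H]
    {B : Type} [Ring B] [Algebra F B] (MB : HMA F H B) (B₀ B₁ : Submodule F B) :
    Submodule F (FreeHMA F H (ℕ ⊕ ℕ)) :=
  ⨅ (v : ℕ ⊕ ℕ → B) (_ : ∀ k, v (Sum.inl k) ∈ B₀) (_ : ∀ k, v (Sum.inr k) ∈ B₁),
    LinearMap.ker (MB.eval F H v).toLinearMap

/-- The subspace of `H`-identities of an `H`-module algebra with the substitutions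
constrained to a subset `N ⊆ B`. -/
def idSubOn (F : Type) [Field F] (H : Type) [Ring H] [Algebra F H] [Coalgebra F H]
    {B : Type} [Ring B] [Algebra F B] (MB : HMA F H B) (N : Set B) :
    Submodule F (FreeHMA F H ℕ) :=
  ⨅ (v : ℕ → B) (_ : ∀ k, v k ∈ N), LinearMap.ker (MB.eval F H v).toLinearMap

/-! ## Auxiliary facts -/

namespace GrassAux

/-- The parity part of the Grassmann algebra: `true` is even. -/
def gpart (F : Type) [Field F] (p : Bool) : Submodule F (GrassmannAlg F) :=
  if p then grassEven F else grassOdd F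

/-- The commutation sign. -/
def csign (F : Type) [Field F] (p q : Bool) : F := if p || q then 1 else -1

theorem csign_sq (F : Type) [Field F] (p q : Bool) : csign F p q * csign F p q = 1 := by
  cases p <;> cases q <;> simp [csign]

theorem iota_comm_list (F : Type) [Field F] (m : ℕ →₀ F) (l : List (ℕ →₀ F)) :
    ExteriorAlgebra.ι F m * (l.map (ExteriorAlgebra.ι F)).prod
      = (-1 : F) ^ l.length • ((l.map (ExteriorAlgebra.ι F)).prod * ExteriorAlgebra.ι F m) := by
  induction l with
  | nil => simp
  | cons a l ih =>
    have h : ExteriorAlgebra.ι F m * ExteriorAlgebra.ι F a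
        = - (ExteriorAlgebra.ι F a * ExteriorAlgebra.ι F m) :=
      eq_neg_of_add_eq_zero_left (ExteriorAlgebra.ι_add_mul_swap m a)
    simp only [List.map_cons, List.prod_cons, List.length_cons]
    rw [← mul_assoc, h, neg_mul, mul_assoc, ih, mul_smul_comm, pow_succ, mul_assoc]
    simp

theorem list_comm_list (F : Type) [Field F] (k l : List (ℕ →₀ F)) :
    (k.map (ExteriorAlgebra.ι F)).prod * (l.map (ExteriorAlgebra.ι F)).prod
      = (-1 : F) ^ (k.length * l.length) •
        ((l.map (ExteriorAlgebra.ι F)).prod * (k.map (ExteriorAlgebra.ι F)).prod) := by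
  induction k with
  | nil => simp
  | cons a k ih =>
    simp only [List.map_cons, List.prod_cons, List.length_cons]
    rw [mul_assoc, ih, mul_smul_comm, ← mul_assoc, iota_comm_list, smul_mul_assoc, smul_smul,
      ← pow_add, mul_assoc]
    congr 2
    ring

theorem gpart_eq (F : Type) [Field F] (p : Bool) : gpart F p = 
  Submodule.span F {x | ∃ l : List (ℕ →₀ F), l.length % 2 = (if p then 0 else 1) ∧
    x = (l.map (ExteriorAlgebra.ι F)).prod} := by
  cases p <;> simp [gpart, grassEven, grassOdd]

theorem gpart_comm (F : Type) [Field F] (p q : Bool) (x y : GrassmannAlg F)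
    (hx : x ∈ gpart F p) (hy : y ∈ gpart F q) : x * y = csign F p q • (y * x) := by
  rw [gpart_eq] at hx hy
  induction hx using Submodule.span_induction with
  | zero => simp
  | add a b _ _ ha hb => rw [add_mul, mul_add, smul_add, ha, hb]
  | smul c a _ ha => rw [smul_mul_assoc, ha, mul_smul_comm, smul_comm]
  | mem a ha =>
    obtain ⟨k, hk, rfl⟩ := ha
    induction hy using Submodule.span_induction with
    | zero => simp
    | add a b _ _ ha hb => rw [add_mul, mul_add, smul_add, ha, hb]
    | smul c a _ ha => rw [smul_mul_assoc, mul_smul_comm, ha, smul_comm]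
    | mem b hb =>
      obtain ⟨l, hl, rfl⟩ := hb
      rw [list_comm_list]
      congr 1
      have key : ∀ m : ℕ, (-1 : F) ^ m = if m % 2 = 0 then 1 else -1 := by
        intro m
        rcases Nat.even_or_odd m with h | h
        · rw [h.neg_one_pow, if_pos (Nat.even_iff.1 h)]
        · rw [h.neg_one_pow, if_neg (by rw [Nat.odd_iff.1 h]; decide)]
      rw [key, Nat.mul_mod, hk, hl]
      cases p <;> cases q <;> simp [csign]

/-- Permuting homogeneous factors only changes a sign depending on the parities. -/
theorem perm_prod (F : Type) [Field F] {I : Type} (p : I → Bool) {l l' : List I}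
    (h : l.Perm l') : ∃ δ : F, δ * δ = 1 ∧ ∀ g : I → GrassmannAlg F,
      (∀ i, g i ∈ gpart F (p i)) → (l.map g).prod = δ • (l'.map g).prod := by
  induction h with
  | nil => exact ⟨1, by simp, by simp⟩
  | cons a _ ih =>
    obtain ⟨δ, h1, h2⟩ := ih
    exact ⟨δ, h1, fun g hg => by simp [h2 g hg]⟩
  | swap a b l =>
    refine ⟨csign F (p b) (p a), csign_sq _ _ _, fun g hg => ?_⟩
    simp only [List.map_cons, List.prod_cons]
    rw [← mul_assoc, gpart_comm F _ _ _ _ (hg b) (hg a), smul_mul_assoc, mul_assoc]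
  | trans _ _ ih ih' =>
    obtain ⟨δ, h1, h2⟩ := ih
    obtain ⟨δ', h1', h2'⟩ := ih'
    refine ⟨δ * δ', by rw [mul_mul_mul_comm, h1, h1', one_mul], fun g hg => ?_⟩
    rw [h2 g hg, h2' g hg, smul_smul]

/-- Vandermonde-type alternating maps. -/
def vand (F : Type) [Field F] (k : ℕ) : (ℕ →₀ F) [⋀^Fin k]→ₗ[F] F :=
  (Matrix.detRowAlternating (n := Fin k) (R := F)).compLinearMap
    (LinearMap.pi fun c : Fin k => Finsupp.linearCombination F fun i : ℕ => (i : F) ^ (c : ℕ))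

/-- A functional on the Grassmann algebra nonvanishing on products of distinct generators. -/
def lam (F : Type) [Field F] : GrassmannAlg F →ₗ[F] F :=
  ExteriorAlgebra.liftAlternating (vand F)

theorem lam_ne (F : Type) [Field F] [CharZero F] (l : List ℕ) (hl : l.Nodup) :
    lam F ((l.map fun i => ExteriorAlgebra.ι F (Finsupp.single i (1 : F))).prod) ≠ 0 := by
  have h1 : (l.map fun i => ExteriorAlgebra.ι F (Finsupp.single i (1 : F))).prod
      = ExteriorAlgebra.ιMulti F l.length (fun k => Finsupp.single (l.get k) (1 : F)) := by
    rw [ExteriorAlgebra.ιMulti_apply]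
    congr 1
    conv_lhs => rw [← List.ofFn_get l, List.map_ofFn]
    rfl
  rw [h1, lam, ExteriorAlgebra.liftAlternating_apply_ιMulti]
  have h2 : vand F l.length (fun k => Finsupp.single (l.get k) (1 : F))
      = (Matrix.vandermonde fun k => ((l.get k : ℕ) : F)).det := by
    change Matrix.det _ = _
    congr 1
    ext i j
    simp [Matrix.vandermonde_apply]
  rw [h2, Matrix.det_vandermonde_ne_zero_iff]
  intro a b hab
  exact hl.injective_get (Nat.cast_injective hab)

/-- Grassmann label of a variable. -/
def gen (F : Type) [Field F] : ℕ ⊕ ℕ → GrassmannAlg F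
  | Sum.inl _ => 1
  | Sum.inr i => ExteriorAlgebra.ι F (Finsupp.single i (1 : F))

/-- Grassmann label by parity. -/
def gpar (F : Type) [Field F] (p : Bool) (i : ℕ) : GrassmannAlg F :=
  if p then 1 else ExteriorAlgebra.ι F (Finsupp.single i (1 : F))

theorem gpar_mem (F : Type) [Field F] (p : Bool) (i : ℕ) : gpar F p i ∈ gpart F p := by
  rw [gpart_eq]
  apply Submodule.subset_span
  cases p
  · exact ⟨[Finsupp.single i 1], by simp, by simp [gpar]⟩
  · exact ⟨[], by simp, by simp [gpar]⟩

theorem lam_gpar_ne (F : Type) [Field F] [CharZero F] {n : ℕ} (p : Fin n → Bool)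
    (l : List (Fin n)) (hl : l.Nodup) :
    lam F ((l.map fun i => gpar F (p i) (i : ℕ)).prod) ≠ 0 := by
  have h : (l.map fun i => gpar F (p i) (i : ℕ)).prod
      = (((l.filter fun i => !p i).map fun i : Fin n => (i : ℕ)).map
        fun i => ExteriorAlgebra.ι F (Finsupp.single i (1 : F))).prod := by
    clear hl
    induction l with
    | nil => simp
    | cons a l ih =>
      rw [List.map_cons, List.prod_cons, ih, List.filter_cons]
      cases h : p a <;> simp [gpar]
  rw [h]
  exact lam_ne F _ ((hl.filter _).map Fin.val_injective)

section Phi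

variable (F : Type) [Field F] (H : Type) [Ring H] [Algebra F H]

theorem lin_ext {V N : Type} [AddCommGroup N] [Module F N]
    {f g : ((V →₀ F) ⊗[F] H) →ₗ[F] N}
    (h : ∀ v k, f (Finsupp.single v 1 ⊗ₜ k) = g (Finsupp.single v 1 ⊗ₜ k)) : f = g := by
  apply TensorProduct.ext
  apply Finsupp.lhom_ext'
  intro v
  ext k
  simpa using h v k

theorem alg_ext {V N : Type} [Ring N] [Algebra F N] {f g : FreeHMA F H V →ₐ[F] N}
    (h : ∀ v k, f (xvar F H v k) = g (xvar F H v k)) : f = g := by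
  apply TensorAlgebra.hom_ext
  apply lin_ext
  intro v k
  exact h v k

/-- `x_v^h` as a linear map in `h`. -/
def xlin {V : Type} (v : V) : H →ₗ[F] FreeHMA F H V :=
  (TensorAlgebra.ι F).comp (TensorProduct.mk F (V →₀ F) H (Finsupp.single v 1))

/-- Attach Grassmann labels to the variables. -/
def Phi : FreeHMA F H (ℕ ⊕ ℕ) →ₐ[F] (FreeHMA F H (ℕ ⊕ ℕ) ⊗[F] GrassmannAlg F) :=
  TensorAlgebra.lift F (TensorProduct.lift (Finsupp.linearCombination F fun v =>
    ((TensorProduct.mk F (FreeHMA F H (ℕ ⊕ ℕ)) (GrassmannAlg F)).flip (gen F v)).comp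
      (xlin F H v)))

theorem Phi_xvar (v : ℕ ⊕ ℕ) (h : H) :
    Phi F H (xvar F H v h) = xvar F H v h ⊗ₜ gen F v := by
  simp [Phi, xvar, xlin]

/-- The sign-twisting map. -/
def tau : FreeHMA F H (ℕ ⊕ ℕ) →ₗ[F] FreeHMA F H (ℕ ⊕ ℕ) :=
  (TensorProduct.rid F _).toLinearMap ∘ₗ (LinearMap.lTensor _ (lam F)) ∘ₗ (Phi F H).toLinearMap

theorem ofFn_tmul_prod {A B : Type} [Ring A] [Algebra F A] [Ring B] [Algebra F B] :
    ∀ (n : ℕ) (a : Fin n → A) (b : Fin n → B),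
    (List.ofFn fun k => a k ⊗ₜ[F] b k).prod = (List.ofFn a).prod ⊗ₜ[F] (List.ofFn b).prod
  | 0, _, _ => by simp [Algebra.TensorProduct.one_def]
  | n + 1, a, b => by
    rw [List.ofFn_succ, List.ofFn_succ, List.ofFn_succ, List.prod_cons, List.prod_cons,
      List.prod_cons, ofFn_tmul_prod n, Algebra.TensorProduct.tmul_mul_tmul]

theorem tau_mono {n : ℕ} (v : Fin n → ℕ ⊕ ℕ) (h : Fin n → H) :
    tau F H (List.ofFn fun k => xvar F H (v k) (h k)).prod
      = lam F (List.ofFn fun k => gen F (v k)).prod •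
        (List.ofFn fun k => xvar F H (v k) (h k)).prod := by
  have : Phi F H (List.ofFn fun k => xvar F H (v k) (h k)).prod
      = (List.ofFn fun k => xvar F H (v k) (h k)).prod ⊗ₜ
        (List.ofFn fun k => gen F (v k)).prod := by
    rw [map_list_prod, List.map_ofFn, ← ofFn_tmul_prod]
    congr 2
    funext k
    exact Phi_xvar F H _ _
  simp [tau, this]

variable [Coalgebra F H]

theorem eval_xvar {V A : Type} [Ring A] [Algebra F A] (M : HMA F H A) (v : V → A) (w : V)
    (h : H) : M.eval F H v (xvar F H w h) = M.act h (v w) := by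
  simp [HMA.eval, xvar]

theorem eval_mono {V A : Type} [Ring A] [Algebra F A] (M : HMA F H A) (v : V → A) {n : ℕ}
    (w : Fin n → V) (h : Fin n → H) :
    M.eval F H v (List.ofFn fun k => xvar F H (w k) (h k)).prod
      = (List.ofFn fun k => M.act (h k) (v (w k))).prod := by
  rw [map_list_prod, List.map_ofFn]
  congr 2
  funext k
  exact eval_xvar F H _ _ _ _

theorem eval_split {A : Type} [Ring A] [Algebra F A] (M : HMA F H A) (v : ℕ ⊕ ℕ → A)
    (f : FreeHMA F H ℕ) :
    M.eval F H v (splitHom F H f)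
      = M.eval F H (fun k => v (Sum.inl k) + v (Sum.inr k)) f := by
  have : (M.eval F H v).comp (splitHom F H)
      = M.eval F H (fun k => v (Sum.inl k) + v (Sum.inr k)) := by
    apply alg_ext
    intro k h
    rw [eval_xvar]
    simp [splitHom, xvar, HMA.eval, TensorProduct.add_tmul]
  exact DFunLike.congr_fun this f

variable {A : Type} [Ring A] [Algebra F A] (MA : HMA F H A)
  (ME : HMA F H (A ⊗[F] GrassmannAlg F))
  (hME : ∀ (h : H) (a : A) (e : GrassmannAlg F),
      ME.act h (a ⊗ₜ[F] e) = MA.act h a ⊗ₜ[F] e)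

include hME in
theorem eval_Phi (v : ℕ ⊕ ℕ → A) (f : FreeHMA F H (ℕ ⊕ ℕ)) :
    Algebra.TensorProduct.map (MA.eval F H v) (AlgHom.id F (GrassmannAlg F)) (Phi F H f)
      = ME.eval F H (fun w => v w ⊗ₜ gen F w) f := by
  have : (Algebra.TensorProduct.map (MA.eval F H v) (AlgHom.id F (GrassmannAlg F))).comp
      (Phi F H) = ME.eval F H (fun w => v w ⊗ₜ gen F w) := by
    apply alg_ext
    intro w h
    rw [eval_xvar, hME, AlgHom.comp_apply, Phi_xvar, Algebra.TensorProduct.map_tmul, eval_xvar]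
    rfl
  exact DFunLike.congr_fun this f

include hME in
theorem eval_tau (v : ℕ ⊕ ℕ → A) (f : FreeHMA F H (ℕ ⊕ ℕ)) :
    MA.eval F H v (tau F H f) = TensorProduct.rid F A
      (LinearMap.lTensor A (lam F) (ME.eval F H (fun w => v w ⊗ₜ gen F w) f)) := by
  rw [← eval_Phi F H MA ME hME]
  simp only [tau, LinearMap.comp_apply, AlgHom.toLinearMap_apply, LinearEquiv.coe_coe]
  generalize Phi F H f = t
  induction t using TensorProduct.induction_on with
  | zero => simp
  | add a b ha hb => simp only [map_add, ha, hb]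
  | tmul a b => simp

variable (A₀ A₁ : Submodule F A)

theorem mem_superId {B : Type} [Ring B] [Algebra F B] (MB : HMA F H B) (B₀ B₁ : Submodule F B)
    (f : FreeHMA F H (ℕ ⊕ ℕ)) : f ∈ superIdSub F H MB B₀ B₁ ↔
      ∀ v : ℕ ⊕ ℕ → B, (∀ k, v (Sum.inl k) ∈ B₀) → (∀ k, v (Sum.inr k) ∈ B₁) →
        MB.eval F H v f = 0 := by
  simp [superIdSub, Submodule.mem_iInf]

include hME in
theorem tau_mem (f : FreeHMA F H (ℕ ⊕ ℕ))
    (hf : f ∈ superIdSub F H ME (envPart F A₀ (grassEven F)) (envPart F A₁ (grassOdd F))) :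
    tau F H f ∈ superIdSub F H MA A₀ A₁ := by
  rw [mem_superId] at hf ⊢
  intro v h0 h1
  rw [eval_tau F H MA ME hME, hf, map_zero, map_zero]
  · intro k
    exact Submodule.subset_span ⟨_, h0 k, _, gpar_mem F true k, rfl⟩
  · intro k
    exact Submodule.subset_span ⟨_, h1 k, _, gpar_mem F false k, rfl⟩

theorem exists_multilinear {B : Type} [Ring B] [Algebra F B] (MB : HMA F H B) (n : ℕ)
    (f : FreeHMA F H (ℕ ⊕ ℕ)) (hf : f ∈ PnH2 F H n) :
    ∃ μ : MultilinearMap F (fun _ : Fin n => B × B) B, ∀ v : ℕ ⊕ ℕ → B,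
      MB.eval F H v f = μ fun i => (v (Sum.inl i), v (Sum.inr i)) := by
  induction hf using Submodule.span_induction with
  | zero => exact ⟨0, by simp⟩
  | add a b _ _ ha hb =>
    obtain ⟨μ, h⟩ := ha
    obtain ⟨ν, h'⟩ := hb
    exact ⟨μ + ν, fun v => by simp [h, h']⟩
  | smul c a _ ha =>
    obtain ⟨μ, h⟩ := ha
    exact ⟨c • μ, fun v => by simp [h]⟩
  | mem m hm =>
    obtain ⟨σ, ε, h, rfl⟩ := hm
    refine ⟨((MultilinearMap.mkPiAlgebraFin F n B).compLinearMap (fun k =>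
      (MB.act (h k)).comp (if ε k then LinearMap.fst F B B else LinearMap.snd F B B))).domDomCongr
        σ, fun v => ?_⟩
    rw [eval_mono]
    simp only [MultilinearMap.domDomCongr_apply, MultilinearMap.compLinearMap_apply,
      MultilinearMap.mkPiAlgebraFin_apply]
    congr 2
    funext k
    cases ε k <;> simp

theorem multilinear_span {B C I : Type} [AddCommGroup B] [Module F B] [AddCommGroup C]
    [Module F C] [Fintype I] [DecidableEq I] (μ : MultilinearMap F (fun _ : I => B) C) (S : Set B)
    (h : ∀ w : I → B, (∀ i, w i ∈ S) → μ w = 0) (w : I → B)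
    (hw : ∀ i, w i ∈ Submodule.span F S) : μ w = 0 := by
  have key : ∀ (s : Finset I) (w : I → B), (∀ i ∈ s, w i ∈ Submodule.span F S) →
      (∀ i, i ∉ s → w i ∈ S) → μ w = 0 := by
    intro s
    induction s using Finset.induction_on with
    | empty => exact fun w _ h' => h w fun i => h' i (by simp)
    | insert a s ha ih =>
      intro w h1 h2
      have : ∀ x ∈ Submodule.span F S, μ (Function.update w a x) = 0 := by
        intro x hx
        induction hx using Submodule.span_induction with
        | zero => exact μ.map_coord_zero a (by simp)
        | add x y _ _ hx hy => rw [MultilinearMap.map_update_add, hx, hy, add_zero]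
        | smul c x _ hx => rw [MultilinearMap.map_update_smul, hx, smul_zero]
        | mem x hx =>
          apply ih
          · intro i hi
            have : i ≠ a := fun e => ha (e ▸ hi)
            rw [Function.update_of_ne this]
            exact h1 i (Finset.mem_insert_of_mem hi)
          · intro i hi
            by_cases e : i = a
            · subst e; simpa using hx
            · rw [Function.update_of_ne e]
              exact h2 i (by simp [e, hi])
      have := this (w a) (h1 a (by simp))
      rwa [Function.update_eq_self] at this
  exact key Finset.univ w (fun i _ => hw i) (by simp)

include hME in
theorem eval_pure [CharZero F] (n : ℕ) (p : Fin n → Bool) (g : Fin n → GrassmannAlg F)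
    (hg : ∀ i, g i ∈ gpart F (p i)) (aa : ℕ ⊕ ℕ → A) (gg : ℕ ⊕ ℕ → GrassmannAlg F)
    (hl : ∀ i : Fin n, p i = false → aa (Sum.inl (i : ℕ)) = 0)
    (hr : ∀ i : Fin n, p i = true → aa (Sum.inr (i : ℕ)) = 0)
    (hgl : ∀ i : Fin n, gg (Sum.inl (i : ℕ)) = g i)
    (hgr : ∀ i : Fin n, gg (Sum.inr (i : ℕ)) = g i)
    (f : FreeHMA F H (ℕ ⊕ ℕ)) (hf : f ∈ PnH2 F H n) :
    ME.eval F H (fun w => aa w ⊗ₜ gg w) f = MA.eval F H aa (tau F H f) ⊗ₜ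
      ((lam F ((List.finRange n).map fun i => gpar F (p i) (i : ℕ)).prod)⁻¹ •
        ((List.finRange n).map g).prod) := by
  induction hf using Submodule.span_induction with
  | zero => simp
  | add a b _ _ ha hb => simp only [map_add, ha, hb, TensorProduct.add_tmul]
  | smul c a _ ha => simp only [map_smul, ha, TensorProduct.smul_tmul']
  | mem m hm =>
    obtain ⟨σ, ε, h, rfl⟩ := hm
    rw [tau_mono, map_smul, eval_mono, eval_mono]
    simp only [hME]
    rw [ofFn_tmul_prod]
    have hG : (List.ofFn fun k => gg (if ε k then Sum.inl ((σ k : Fin n) : ℕ)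
        else Sum.inr ((σ k : Fin n) : ℕ))) = (List.ofFn σ).map g := by
      rw [List.map_ofFn]
      congr 1
      funext k
      cases ε k <;> simp [hgl, hgr]
    rw [hG]
    by_cases hm : ∀ k, ε k = p (σ k)
    · have hE : (List.ofFn fun k => gen F (if ε k then Sum.inl ((σ k : Fin n) : ℕ)
          else Sum.inr ((σ k : Fin n) : ℕ)))
          = (List.ofFn σ).map fun i => gpar F (p i) (i : ℕ) := by
        rw [List.map_ofFn]
        congr 1
        funext k
        simp only [Function.comp, ← hm]
        cases ε k <;> simp [gpar, gen]
      rw [hE]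
      have hperm : (List.ofFn σ).Perm (List.finRange n) := by
        have := σ.ofFn_comp_perm (id : Fin n → Fin n)
        rwa [List.ofFn_id, Function.id_comp] at this
      obtain ⟨δ, h1, h2⟩ := perm_prod F p hperm
      rw [h2 g hg, h2 _ fun i => gpar_mem F (p i) i, map_smul]
      have hne := lam_gpar_ne F p (List.finRange n) (List.nodup_finRange n)
      rw [TensorProduct.smul_tmul, smul_smul, smul_eq_mul, mul_assoc, mul_inv_cancel₀ hne,
        mul_one]
    · push Not at hm
      obtain ⟨k, hk⟩ := hm
      have hz : (List.ofFn fun k => MA.act (h k) (aa (if ε k then Sum.inl ((σ k : Fin n) : ℕ)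
          else Sum.inr ((σ k : Fin n) : ℕ)))).prod = 0 := by
        apply List.prod_eq_zero
        rw [List.mem_ofFn]
        refine ⟨k, ?_⟩
        cases he : ε k
        · rw [he] at hk
          simp [hr (σ k) (by simpa using hk.symm)]
        · rw [he] at hk
          simp [hl (σ k) (by simpa using hk.symm)]
      rw [hz]
      simp

include hME in
theorem mem_of_tau_mem [CharZero F] (n : ℕ) (f : FreeHMA F H (ℕ ⊕ ℕ)) (hf : f ∈ PnH2 F H n)
    (ht : tau F H f ∈ superIdSub F H MA A₀ A₁) :
    f ∈ superIdSub F H ME (envPart F A₀ (grassEven F)) (envPart F A₁ (grassOdd F)) := by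
  classical
  rw [mem_superId] at ht ⊢
  intro v h0 h1
  obtain ⟨μ, hμ⟩ := exists_multilinear F H ME n f hf
  rw [hμ]
  let T : Bool → A → GrassmannAlg F → (A ⊗[F] GrassmannAlg F) × (A ⊗[F] GrassmannAlg F) :=
    fun p a e => ((if p then a else 0) ⊗ₜ e, (if p then 0 else a) ⊗ₜ e)
  let S : Set ((A ⊗[F] GrassmannAlg F) × (A ⊗[F] GrassmannAlg F)) :=
    {x | ∃ (p : Bool) (a : A) (e : GrassmannAlg F), a ∈ (if p then A₀ else A₁) ∧
      e ∈ gpart F p ∧ x = T p a e}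
  apply multilinear_span F μ S
  · intro w hw
    choose p a g ha hg hx using hw
    let aa : ℕ ⊕ ℕ → A := Sum.elim
      (fun k => if hk : k < n then (if p ⟨k, hk⟩ then a ⟨k, hk⟩ else 0) else 0)
      (fun k => if hk : k < n then (if p ⟨k, hk⟩ then 0 else a ⟨k, hk⟩) else 0)
    let gg : ℕ ⊕ ℕ → GrassmannAlg F := Sum.elim
      (fun k => if hk : k < n then g ⟨k, hk⟩ else 0)
      (fun k => if hk : k < n then g ⟨k, hk⟩ else 0)
    have hw' : w = fun i : Fin n => (aa (Sum.inl (i : ℕ)) ⊗ₜ[F] gg (Sum.inl (i : ℕ)),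
        aa (Sum.inr (i : ℕ)) ⊗ₜ[F] gg (Sum.inr (i : ℕ))) := by
      funext i
      rw [hx i]
      simp [T, aa, gg]
    rw [hw', ← hμ fun w => aa w ⊗ₜ gg w,
      eval_pure F H MA ME hME n p g hg aa gg (fun i hi => by simp [aa, hi])
        (fun i hi => by simp [aa, hi]) (fun i => by simp [gg]) (fun i => by simp [gg]) f hf,
      ht, TensorProduct.zero_tmul]
    · intro k
      simp only [aa, Sum.elim_inl]
      split_ifs with hk hp
      · simpa [hp] using ha ⟨k, hk⟩
      · exact zero_mem _
      · exact zero_mem _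
    · intro k
      simp only [aa, Sum.elim_inr]
      split_ifs with hk hp
      · exact zero_mem _
      · simpa [hp] using ha ⟨k, hk⟩
      · exact zero_mem _
  · intro i
    have e : (v (Sum.inl (i : ℕ)), v (Sum.inr (i : ℕ)))
        = LinearMap.inl F _ _ (v (Sum.inl (i : ℕ))) + LinearMap.inr F _ _ (v (Sum.inr (i : ℕ))) := by
      simp
    rw [e]
    refine add_mem ?_ ?_
    · have : envPart F A₀ (grassEven F) ≤ (Submodule.span F S).comap (LinearMap.inl F _ _) := by
        refine Submodule.span_le.2 ?_
        rintro _ ⟨a, ha, e, he, rfl⟩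
        exact Submodule.subset_span ⟨true, a, e, by simpa using ha, he, by simp [T]⟩
      exact this (h0 i)
    · have : envPart F A₁ (grassOdd F) ≤ (Submodule.span F S).comap (LinearMap.inr F _ _) := by
        refine Submodule.span_le.2 ?_
        rintro _ ⟨a, ha, e, he, rfl⟩
        exact Submodule.subset_span ⟨false, a, e, by simpa using ha, he, by simp [T]⟩
      exact this (h1 i)

end Phi

section Dim

variable (F : Type) [Field F] (H : Type) [Ring H] [Algebra F H]

theorem tau_map [CharZero F] (n : ℕ) : (PnH2 F H n).map (tau F H) = PnH2 F H n := by
  have hE : ∀ (σ : Equiv.Perm (Fin n)) (ε : Fin n → Bool),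
      lam F (List.ofFn fun k => gen F (if ε k then Sum.inl ((σ k : Fin n) : ℕ)
          else Sum.inr ((σ k : Fin n) : ℕ))).prod ≠ 0 := by
    intro σ ε
    have : (List.ofFn fun k => gen F (if ε k then Sum.inl ((σ k : Fin n) : ℕ)
          else Sum.inr ((σ k : Fin n) : ℕ)))
          = (List.ofFn σ).map fun i => gpar F (ε (σ.symm i)) (i : ℕ) := by
        rw [List.map_ofFn]
        congr 1
        funext k
        simp only [Function.comp, Equiv.symm_apply_apply]
        cases ε k <;> simp [gpar, gen]
    rw [this]
    exact lam_gpar_ne F _ _ (List.nodup_ofFn.2 σ.injective)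
  apply le_antisymm
  · rw [PnH2, Submodule.map_span, Submodule.span_le]
    rintro _ ⟨_, ⟨σ, ε, h, rfl⟩, rfl⟩
    rw [tau_mono]
    exact Submodule.smul_mem _ _ (Submodule.subset_span ⟨σ, ε, h, rfl⟩)
  · conv_lhs => rw [PnH2]
    rw [Submodule.span_le]
    rintro _ ⟨σ, ε, h, rfl⟩
    refine ⟨(lam F (List.ofFn fun k => gen F (if ε k then Sum.inl ((σ k : Fin n) : ℕ)
          else Sum.inr ((σ k : Fin n) : ℕ))).prod)⁻¹ • _,
      Submodule.smul_mem _ _ (Submodule.subset_span ⟨σ, ε, h, rfl⟩), ?_⟩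
    rw [map_smul, tau_mono, smul_smul, inv_mul_cancel₀ (hE σ ε), one_smul]

theorem split_mem (n : ℕ) (f : FreeHMA F H ℕ) (hf : f ∈ PnH F H n) :
    splitHom F H f ∈ PnH2 F H n := by
  classical
  have : PnH F H n ≤ (PnH2 F H n).comap (splitHom F H).toLinearMap := by
    refine Submodule.span_le.2 ?_
    rintro _ ⟨σ, h, rfl⟩
    change splitHom F H _ ∈ PnH2 F H n
    rw [map_list_prod, List.map_ofFn]
    have hx : (⇑(splitHom F H) ∘ fun k => xvar F H ((σ k : Fin n) : ℕ) (h k))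
        = (fun k => xvar F H (Sum.inl ((σ k : Fin n) : ℕ)) (h k))
          + fun k => xvar F H (Sum.inr ((σ k : Fin n) : ℕ)) (h k) := by
      funext k
      simp [splitHom, xvar, TensorProduct.add_tmul]
    rw [hx, ← MultilinearMap.mkPiAlgebraFin_apply (R := F), MultilinearMap.map_add_univ]
    refine sum_mem fun s _ => ?_
    rw [MultilinearMap.mkPiAlgebraFin_apply]
    refine Submodule.subset_span ⟨σ, fun k => decide (k ∈ s), h, ?_⟩
    congr 2
    funext k
    by_cases hk : k ∈ s <;> simp [hk]
  exact this hf

theorem PnH2_fg [FiniteDimensional F H] (n : ℕ) : (PnH2 F H n).FG := by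
  let W : Submodule F (FreeHMA F H (ℕ ⊕ ℕ)) :=
    ⨆ v : Fin n ⊕ Fin n, LinearMap.range (xlin F H (Sum.map Fin.val Fin.val v))
  have hW : W.FG := Submodule.fg_iSup _ fun v => Module.Finite.iff_fg.1 (Module.Finite.range _)
  have hle : PnH2 F H n ≤ W ^ n := by
    refine Submodule.span_le.2 ?_
    rintro _ ⟨σ, ε, h, rfl⟩
    apply Submodule.pow_subset_pow
    rw [Set.mem_pow]
    refine ⟨fun k => ⟨_, ?_⟩, rfl⟩
    cases hk : ε k
    · exact (le_iSup (fun v : Fin n ⊕ Fin n =>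
        LinearMap.range (xlin F H (Sum.map Fin.val Fin.val v))) (Sum.inr (σ k))) ⟨h k, by simp [xlin, xvar]⟩
    · exact (le_iSup (fun v : Fin n ⊕ Fin n =>
        LinearMap.range (xlin F H (Sum.map Fin.val Fin.val v))) (Sum.inl (σ k))) ⟨h k, by simp [xlin, xvar]⟩
  exact Submodule.FG.of_le (hW.pow n) hle

/-- the image of a submodule as a quotient -/
def mapEquiv {M N : Type} [AddCommGroup M] [Module F M] [AddCommGroup N] [Module F N]
    (P : Submodule F M) (φ : M →ₗ[F] N) :
    (P ⧸ LinearMap.ker (φ.domRestrict P)) ≃ₗ[F] P.map φ :=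
  (φ.domRestrict P).quotKerEquivRange.trans
    (LinearEquiv.ofEq _ _ (LinearMap.range_domRestrict P φ))

theorem finrank_eq {M N N' : Type} [AddCommGroup M] [Module F M] [AddCommGroup N] [Module F N]
    [AddCommGroup N'] [Module F N'] (P : Submodule F M) (φ : M →ₗ[F] N) (ψ : M →ₗ[F] N')
    (h : ∀ f ∈ P, φ f = 0 ↔ ψ f = 0) :
    Module.finrank F (P.map φ) = Module.finrank F (P.map ψ) := by
  have hk : LinearMap.ker (φ.domRestrict P) = LinearMap.ker (ψ.domRestrict P) := by
    ext ⟨x, hx⟩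
    simpa using h x hx
  exact LinearEquiv.finrank_eq ((mapEquiv F P φ).symm.trans
    ((Submodule.quotEquivOfEq _ _ hk).trans (mapEquiv F P ψ)))

theorem finrank_le {M N N' : Type} [AddCommGroup M] [Module F M] [AddCommGroup N] [Module F N]
    [AddCommGroup N'] [Module F N'] (P : Submodule F M) (φ : M →ₗ[F] N) (ψ : M →ₗ[F] N')
    [FiniteDimensional F (P.map φ)]
    (h : ∀ f ∈ P, φ f = 0 → ψ f = 0) :
    Module.finrank F (P.map ψ) ≤ Module.finrank F (P.map φ) := by
  have hk : LinearMap.ker (φ.domRestrict P) ≤ LinearMap.ker (ψ.domRestrict P) := by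
    rintro ⟨x, hx⟩ hx'
    simpa using h x hx (by simpa using hx')
  rw [← (mapEquiv F P φ).finrank_eq, ← (mapEquiv F P ψ).finrank_eq]
  haveI := Module.Finite.equiv (mapEquiv F P φ).symm
  refine LinearMap.finrank_le_finrank_of_surjective (f := Submodule.factor hk) ?_
  exact Submodule.factor_surjective hk

end Dim

end GrassAux

/-- For any `H₂`-module algebra `A` and every `n`, the `H`-codimension
of the Grassmann envelope satisfies `c_n^H(E(A)) ≤ c_n^{H₂}(A)`: the linear map
`P_n^H/(P_n^H ∩ id^H(E(A))) → P_n^{H₂}/(P_n^{H₂} ∩ id^{H₂}(E(A)))` induced by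
`x_i ↦ y_i + z_i` is injective, and `c_n^{H₂}(E(A)) = c_n^{H₂}(A)`. -/
theorem grassmann_codimension_bound
    (F : Type) [Field F] [CharZero F] (H : Type) [Ring H] [HopfAlgebra F H]
    [FiniteDimensional F H] [IsSemisimpleRing H]
    (A : Type) [Ring A] [Algebra F A] [FiniteDimensional F A] (MA : HMA F H A)
    (A₀ A₁ : Submodule F A) (hcompl : IsCompl A₀ A₁)
    (hone : (1 : A) ∈ A₀)
    (hmul00 : ∀ x ∈ A₀, ∀ y ∈ A₀, x * y ∈ A₀) (hmul11 : ∀ x ∈ A₁, ∀ y ∈ A₁, x * y ∈ A₀)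
    (hmul01 : ∀ x ∈ A₀, ∀ y ∈ A₁, x * y ∈ A₁) (hmul10 : ∀ x ∈ A₁, ∀ y ∈ A₀, x * y ∈ A₁)
    (hstable0 : ∀ (h : H), ∀ x ∈ A₀, MA.act h x ∈ A₀)
    (hstable1 : ∀ (h : H), ∀ x ∈ A₁, MA.act h x ∈ A₁)
    (ME : HMA F H (A ⊗[F] GrassmannAlg F))
    (hME : ∀ (h : H) (a : A) (e : GrassmannAlg F),
      ME.act h (a ⊗ₜ[F] e) = MA.act h a ⊗ₜ[F] e)
    (n : ℕ) :
    -- injectivity of the induced map `P_n^H(E(A)) → P_n^{H₂}(E(A))`: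
    (∀ f ∈ PnH F H n,
      splitHom F H f ∈ superIdSub F H ME (envPart F A₀ (grassEven F))
          (envPart F A₁ (grassOdd F)) →
      f ∈ idSubOn F H ME
          ↑(envPart F A₀ (grassEven F) ⊔ envPart F A₁ (grassOdd F))) ∧
    -- `c_n^{H₂}(E(A)) = c_n^{H₂}(A)`:
    (Module.finrank F ((PnH2 F H n).map (superIdSub F H ME
        (envPart F A₀ (grassEven F)) (envPart F A₁ (grassOdd F))).mkQ)
      = Module.finrank F ((PnH2 F H n).map (superIdSub F H MA A₀ A₁).mkQ)) ∧
    -- `c_n^H(E(A)) ≤ c_n^{H₂}(A)`: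
    (Module.finrank F ((PnH F H n).map (idSubOn F H ME
        ↑(envPart F A₀ (grassEven F) ⊔ envPart F A₁ (grassOdd F))).mkQ)
      ≤ Module.finrank F ((PnH2 F H n).map (superIdSub F H MA A₀ A₁).mkQ)) := by
  have part1 : ∀ f ∈ PnH F H n,
      splitHom F H f ∈ superIdSub F H ME (envPart F A₀ (grassEven F))
          (envPart F A₁ (grassOdd F)) →
      f ∈ idSubOn F H ME
          ↑(envPart F A₀ (grassEven F) ⊔ envPart F A₁ (grassOdd F)) := by
    intro f _ hs
    rw [GrassAux.mem_superId] at hs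
    simp only [idSubOn, Submodule.mem_iInf, LinearMap.mem_ker, AlgHom.toLinearMap_apply]
    intro v hv
    have hv' : ∀ k, ∃ b ∈ envPart F A₀ (grassEven F), ∃ c ∈ envPart F A₁ (grassOdd F),
        b + c = v k := fun k => Submodule.mem_sup.1 (hv k)
    choose b hb c hc hbc using hv'
    have := hs (Sum.elim b c) hb hc
    rw [GrassAux.eval_split] at this
    simpa [hbc] using this
  have part2 : Module.finrank F ((PnH2 F H n).map (superIdSub F H ME
        (envPart F A₀ (grassEven F)) (envPart F A₁ (grassOdd F))).mkQ)
      = Module.finrank F ((PnH2 F H n).map (superIdSub F H MA A₀ A₁).mkQ) := by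
    have h1 := GrassAux.finrank_eq F (PnH2 F H n) (superIdSub F H ME
        (envPart F A₀ (grassEven F)) (envPart F A₁ (grassOdd F))).mkQ
        ((superIdSub F H MA A₀ A₁).mkQ ∘ₗ GrassAux.tau F H) (fun f hf => by
          simp only [LinearMap.comp_apply, Submodule.mkQ_apply, Submodule.Quotient.mk_eq_zero]
          exact ⟨GrassAux.tau_mem F H MA ME hME A₀ A₁ f,
            GrassAux.mem_of_tau_mem F H MA ME hME A₀ A₁ n f hf⟩)
    rw [h1, Submodule.map_comp, GrassAux.tau_map]
  refine ⟨part1, part2, ?_⟩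
  rw [← part2]
  haveI : FiniteDimensional F (PnH2 F H n) := Module.Finite.iff_fg.2 (GrassAux.PnH2_fg F H n)
  let q := (superIdSub F H ME
        (envPart F A₀ (grassEven F)) (envPart F A₁ (grassOdd F))).mkQ
  have hle : (PnH F H n).map (q ∘ₗ (splitHom F H).toLinearMap) ≤ (PnH2 F H n).map q := by
    rintro _ ⟨f, hf, rfl⟩
    exact ⟨_, GrassAux.split_mem F H n f hf, rfl⟩
  haveI : FiniteDimensional F ((PnH2 F H n).map q) := inferInstance
  haveI : FiniteDimensional F ((PnH F H n).map (q ∘ₗ (splitHom F H).toLinearMap)) :=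
    Submodule.finiteDimensional_of_le hle
  refine le_trans (GrassAux.finrank_le F (PnH F H n) (q ∘ₗ (splitHom F H).toLinearMap) _ ?_)
    (Submodule.finrank_mono hle)
  intro f hf h
  simp only [q, LinearMap.comp_apply, Submodule.mkQ_apply, Submodule.Quotient.mk_eq_zero,
    AlgHom.toLinearMap_apply] at h ⊢
  exact part1 f hf h
end
end
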